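/- arXiv:1709.08504 — 2 statements merged into one kernel-verified Lean document; each statement's English description precedes it below -/
import Mathlib

section
/- Fix an integer m ≥ 2 and q ∈ (0,1). For each n, let κ = (k₁,…,k_m) ∈ 𝒫_n(m) be chosen with probability P(κ) = c·q^{k₁}, where c is the normalizing constant. Fix j₀ ∈ {0,1,…,m−1} and consider the subsequence of n with n ≡ j₀ (mod m); define j = j₀ if 1 ≤ j₀ ≤ m−1 and j = m if j₀ = 0. Then as n → ∞ along this subsequence, the largest part satisfies: k₁ − ⌈n/m⌉ converges in distribution to the discrete random variable on {0,1,2,…} with probability mass function f(l) = q^{l}·|𝒫_{ml+m−j}(m−1)| / Σ_{l=0}^∞ q^{l}·|𝒫_{ml+m−j}(m−1)|. -/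
open scoped BigOperators

/-- The set of partitions of `N` into at most `k` parts, encoded as weakly decreasing
functions `Fin k → ℕ` summing to `N`. -/
def restPart (N k : ℕ) : Set (Fin k → ℕ) := {f | Antitone f ∧ ∑ i, f i = N}

/-- The number of partitions of `N` into at most `k` parts. -/
noncomputable def numPart (N k : ℕ) : ℕ := Nat.card (restPart N k)

/-- Total weight `∑ q^{k₁}` of partitions of `n` into at most `m` parts lying in the
event `E`, where `k₁` is the largest part. -/
noncomputable def geomWeight (q : ℝ) (n m : ℕ) (hm : 0 < m) (E : Set (Fin m → ℕ)) : ℝ :=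
  ∑' f : {g : Fin m → ℕ // (Antitone g ∧ ∑ i, g i = n) ∧ g ∈ E}, q ^ (f.1 ⟨0, hm⟩)

/-- Probability of the event `E` under the restricted geometric distribution
`P(κ) = c q^{k₁}` on partitions of `n` into at most `m` parts. -/
noncomputable def geomProb (q : ℝ) (n m : ℕ) (hm : 0 < m) (E : Set (Fin m → ℕ)) : ℝ :=
  geomWeight q n m hm E / geomWeight q n m hm Set.univ

lemma finite_restPart (N k : ℕ) : (restPart N k).Finite := by
  refine (Set.Finite.pi' (fun _ : Fin k => Set.finite_Iic N)).subset ?_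
  rintro f ⟨-, hf⟩ i
  exact hf ▸ Finset.single_le_sum (f := f) (fun _ _ => Nat.zero_le _) (Finset.mem_univ i)

lemma numPart_le_pow (N k : ℕ) : numPart N k ≤ (N + 1) ^ k := by
  have hle : ∀ f : restPart N k, ∀ i, f.1 i < N + 1 := fun f i => by
    have := f.2.2 ▸ Finset.single_le_sum (f := f.1) (fun _ _ => Nat.zero_le _) (Finset.mem_univ i)
    omega
  have h := Nat.card_le_card_of_injective
    (fun (f : restPart N k) (i : Fin k) => (⟨f.1 i, hle f i⟩ : Fin (N + 1))) (by
      intro f g hfg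
      ext i
      simpa using congrFun hfg i)
  simpa [numPart] using h

lemma numPart_pos (N : ℕ) {k : ℕ} (hk : 0 < k) : 0 < numPart N k := by
  have : Finite (restPart N k) := finite_restPart N k
  obtain ⟨k, rfl⟩ := Nat.exists_eq_succ_of_ne_zero hk.ne'
  have : Nonempty (restPart N (k + 1)) := by
    refine ⟨⟨Fin.cons N 0, ?_, ?_⟩⟩
    · rw [Fin.antitone_iff_succ_le]
      intro i
      simp
    · simp [Fin.sum_univ_succ]
  exact Nat.card_pos

/-- Partitions of `n` into at most `k + 1` parts with largest part `K`. -/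
def partsWithMax (n k K : ℕ) : Set (Fin (k + 1) → ℕ) := {g | g ∈ restPart n (k + 1) ∧ g 0 = K}

lemma finite_partsWithMax (n k K : ℕ) : (partsWithMax n k K).Finite :=
  (finite_restPart n (k + 1)).subset fun _ h => h.1

/-- Complementing the parts after the first one with respect to the largest part. -/
lemma mapsTo_complement {n k K N : ℕ} (hN : (k + 1) * K = n + N) :
    Set.MapsTo (fun (g : Fin (k + 1) → ℕ) (i : Fin k) => K - g i.rev.succ)
      (partsWithMax n k K) (restPart N k) := by
  rintro g ⟨⟨hg, hs⟩, h0⟩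
  refine ⟨fun i j hij => ?_, ?_⟩
  · exact Nat.sub_le_sub_left (hg (Fin.succ_le_succ_iff.2 (Fin.rev_le_rev.2 hij))) K
  · have hle : ∀ i : Fin k, g i.succ ≤ K := fun i => h0 ▸ hg (Fin.zero_le _)
    have hrev : ∑ i : Fin k, (K - g i.rev.succ) = ∑ i : Fin k, (K - g i.succ) :=
      Equiv.sum_comp Fin.revPerm fun i : Fin k => K - g i.succ
    have hadd : ∑ i : Fin k, (K - g i.succ) + ∑ i : Fin k, g i.succ = k * K := by
      rw [← Finset.sum_add_distrib]
      simp [Nat.sub_add_cancel (hle _)]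
    rw [Fin.sum_univ_succ, h0] at hs
    simp only [hrev]
    linarith

lemma injOn_complement (n k K : ℕ) :
    Set.InjOn (fun (g : Fin (k + 1) → ℕ) (i : Fin k) => K - g i.rev.succ)
      (partsWithMax n k K) := by
  rintro g ⟨⟨hg, -⟩, hg0⟩ h ⟨⟨hh, -⟩, hh0⟩ hgh
  ext i
  refine Fin.cases (hg0.trans hh0.symm) (fun i => ?_) i
  have h1 := congrFun hgh i.rev
  have h2 : g i.succ ≤ K := hg0 ▸ hg (Fin.zero_le _)
  have h3 : h i.succ ≤ K := hh0 ▸ hh (Fin.zero_le _)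
  simp only [Fin.rev_rev] at h1
  omega

lemma surjOn_complement {n k K N : ℕ} (hN : (k + 1) * K = n + N) (hK : N ≤ K) :
    Set.SurjOn (fun (g : Fin (k + 1) → ℕ) (i : Fin k) => K - g i.rev.succ)
      (partsWithMax n k K) (restPart N k) := by
  rintro f ⟨hf, hs⟩
  have hle : ∀ i, f i ≤ K := fun i =>
    (hs ▸ Finset.single_le_sum (f := f) (fun _ _ => Nat.zero_le _) (Finset.mem_univ i)).trans hK
  refine ⟨Fin.cons K fun i => K - f i.rev, ⟨⟨?_, ?_⟩, rfl⟩, ?_⟩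
  · intro i j
    refine Fin.cases (fun _ => ?_) (fun i => ?_) i
    · refine Fin.cases ?_ (fun j => ?_) j <;> simp
    · refine Fin.cases (fun h => ?_) (fun j h => ?_) j
      · exact absurd h (by simp)
      · simpa only [Fin.cons_succ] using
          Nat.sub_le_sub_left (hf (Fin.rev_le_rev.2 (Fin.succ_le_succ_iff.1 h))) K
  · have hrev : ∑ i : Fin k, (K - f i.rev) = ∑ i : Fin k, (K - f i) :=
      Equiv.sum_comp Fin.revPerm fun i : Fin k => K - f i
    have hadd : ∑ i : Fin k, (K - f i) + ∑ i : Fin k, f i = k * K := by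
      rw [← Finset.sum_add_distrib]
      simp [Nat.sub_add_cancel (hle _)]
    rw [Fin.sum_univ_succ]
    simp only [Fin.cons_zero, Fin.cons_succ, hrev]
    linarith
  · ext i
    have := hle i
    simp only [Fin.cons_succ, Fin.rev_rev]
    omega

lemma ncard_partsWithMax_le {n k K N : ℕ} (hN : (k + 1) * K = n + N) :
    (partsWithMax n k K).ncard ≤ numPart N k :=
  Set.ncard_le_ncard_of_injOn _ (mapsTo_complement hN) (injOn_complement n k K)
    (finite_restPart N k)

lemma ncard_partsWithMax_eq {n k K N : ℕ} (hN : (k + 1) * K = n + N) (hK : N ≤ K) :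
    (partsWithMax n k K).ncard = numPart N k :=
  Set.BijOn.ncard_eq
    ⟨mapsTo_complement hN, injOn_complement n k K, surjOn_complement hN hK⟩

lemma geomWeight_largest_eq (q : ℝ) (n k K : ℕ) :
    geomWeight q n (k + 1) k.succ_pos {f | f 0 = K} = q ^ K * (partsWithMax n k K).ncard := by
  have h : ∀ f : {g : Fin (k + 1) → ℕ // (Antitone g ∧ ∑ i, g i = n) ∧ g ∈ {f | f 0 = K}},
      q ^ (f.1 ⟨0, k.succ_pos⟩) = q ^ K := fun f => congrArg (q ^ ·) f.2.2
  rw [geomWeight, tsum_congr h, tsum_const, nsmul_eq_mul, mul_comm]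
  rfl

lemma geomWeight_univ (q : ℝ) (n k c : ℕ) (hc : ∀ g ∈ restPart n (k + 1), c ≤ g 0) :
    geomWeight q n (k + 1) k.succ_pos Set.univ =
      ∑' l : ℕ, q ^ (c + l) * (partsWithMax n k (c + l)).ncard := by
  let T := {g : Fin (k + 1) → ℕ // (Antitone g ∧ ∑ i, g i = n) ∧ g ∈ Set.univ}
  have : Finite (restPart n (k + 1)) := finite_restPart n (k + 1)
  have : Finite T := Finite.of_injective
    (fun f : T => (⟨f.1, f.2.1⟩ : restPart n (k + 1)))
    fun f g h => Subtype.ext (congrArg (fun x => x.1) h)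
  have : Fintype T := Fintype.ofFinite T
  have hs := (hasSum_fintype fun f : T => q ^ (f.1 0)).summable.hasSum.tsum_fiberwise
    fun f : T => f.1 0 - c
  refine hs.tsum_eq.symm.trans (tsum_congr fun l => ?_)
  rw [← geomWeight_largest_eq, geomWeight]
  let e : {f : T // f.1 0 - c = l} ≃
      {g : Fin (k + 1) → ℕ // (Antitone g ∧ ∑ i, g i = n) ∧ g ∈ {f | f 0 = c + l}} :=
    { toFun := fun f => ⟨f.1.1, f.1.2.1, by
        have h1 := hc f.1.1 f.1.2.1
        have h2 := f.2
        simp only [Set.mem_ofPred_eq]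
        omega⟩
      invFun := fun g => ⟨⟨g.1, g.2.1, trivial⟩, by
        have h : g.1 0 = c + l := g.2.2
        simp [h]⟩
      left_inv := fun _ => rfl
      right_inv := fun _ => rfl }
  exact e.tsum_eq fun g => q ^ (g.1 0)

lemma summable_pow_mul_numPart {q : ℝ} (hq0 : 0 ≤ q) (hq1 : q < 1) (k d : ℕ) :
    Summable fun i : ℕ => q ^ i * (numPart ((k + 1) * i + d) k : ℝ) := by
  have hgeom : Summable fun i : ℕ => ((k + 1 + d + 1 : ℕ) : ℝ) ^ k *
      (((i + 1 : ℕ) : ℝ) ^ k * q ^ i) := by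
    refine Summable.mul_left _ ?_
    rcases hq0.eq_or_lt with rfl | hq
    · refine summable_of_ne_finset_zero (s := {0}) fun i hi => ?_
      simp_all
    · have hnorm : ‖q‖ < 1 := by rwa [Real.norm_of_nonneg hq0]
      have h0 : Summable fun i : ℕ => (i : ℝ) ^ k * q ^ i :=
        summable_pow_mul_geometric_of_norm_lt_one k hnorm
      have h : Summable fun i : ℕ => ((i + 1 : ℕ) : ℝ) ^ k * q ^ (i + 1) :=
        (summable_nat_add_iff (f := fun i : ℕ => (i : ℝ) ^ k * q ^ i) 1).2 h0
      refine (h.mul_left q⁻¹).congr fun i => ?_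
      field_simp
      ring
  refine Summable.of_nonneg_of_le (fun i => by positivity) (fun i => ?_) hgeom
  have h : numPart ((k + 1) * i + d) k ≤ (k + 1 + d + 1) ^ k * (i + 1) ^ k := by
    rw [← mul_pow]
    refine (numPart_le_pow _ _).trans (Nat.pow_le_pow_left ?_ _)
    nlinarith [Nat.zero_le (d * i)]
  calc q ^ i * (numPart ((k + 1) * i + d) k : ℝ)
      ≤ q ^ i * (((k + 1 + d + 1) ^ k * (i + 1) ^ k : ℕ) : ℝ) := by gcongr
    _ = _ := by push_cast; ring

/-- Along the subsequence `n = m t + j₀`, the largest part satisfies: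
`k₁ - ⌈n/m⌉` converges in distribution to the discrete law on `{0,1,2,…}` with pmf
`q^l |𝒫_{ml+m-j}(m-1)| / ∑_{l≥0} q^l |𝒫_{ml+m-j}(m-1)|`. -/
theorem stmt_3 (m : ℕ) (hm : 2 ≤ m) (q : ℝ) (hq : q ∈ Set.Ioo (0 : ℝ) 1)
    (j₀ : ℕ) (hj₀ : j₀ < m) (j : ℕ) (hj : j = if j₀ = 0 then m else j₀)
    (l : ℕ) :
    Filter.Tendsto
      (fun t : ℕ => geomProb q (m * t + j₀) m (by omega)
        {f | (f ⟨0, by omega⟩ : ℤ) = ⌈((m * t + j₀ : ℕ) : ℚ) / (m : ℚ)⌉ + (l : ℤ)})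
      Filter.atTop
      (nhds (q ^ l * (numPart (m * l + m - j) (m - 1) : ℝ) /
        ∑' i : ℕ, q ^ i * (numPart (m * i + m - j) (m - 1) : ℝ))) := by
  obtain ⟨k, rfl⟩ : ∃ k, m = k + 1 := ⟨m - 1, by omega⟩
  obtain ⟨hq0, hq1⟩ := hq
  have hjpos : 1 ≤ j ∧ j ≤ k + 1 := by split_ifs at hj <;> omega
  obtain ⟨d, hd⟩ : ∃ d, d + j = k + 1 := ⟨k + 1 - j, by omega⟩
  have hN : ∀ i, (k + 1) * i + (k + 1) - j = (k + 1) * i + d := fun i => by omega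
  simp only [hN, Nat.add_sub_cancel]
  obtain ⟨ε, hε⟩ : ∃ ε, (k + 1) * ε = j₀ + d := by
    split_ifs at hj
    · exact ⟨0, by omega⟩
    · exact ⟨1, by omega⟩
  have hK : ∀ t i, (k + 1) * (t + ε + i) = (k + 1) * t + j₀ + ((k + 1) * i + d) := fun t i => by
    linarith [mul_add (k + 1) (t + ε) i, mul_add (k + 1) t ε]
  have hceil : ∀ t : ℕ, ⌈(((k + 1) * t + j₀ : ℕ) : ℚ) / ((k + 1 : ℕ) : ℚ)⌉ = ((t + ε : ℕ) : ℤ) := by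
    intro t
    have h : (((k + 1) * (t + ε + 0) : ℕ) : ℚ) = _ := congrArg Nat.cast (hK t 0)
    have hdk : (d : ℚ) < k + 1 := by
      have : d < k + 1 := by omega
      exact_mod_cast this
    push_cast at h
    rw [Int.ceil_eq_iff, lt_div_iff₀ (by positivity), div_le_iff₀ (by positivity)]
    push_cast
    constructor <;> linarith [Nat.cast_nonneg (α := ℚ) d]
  have hmin : ∀ t, ∀ g ∈ restPart ((k + 1) * t + j₀) (k + 1), t + ε ≤ g 0 := by
    rintro t g ⟨hg, hs⟩
    have h1 : ∑ i, g i ≤ ∑ _i : Fin (k + 1), g 0 := Finset.sum_le_sum fun i _ => hg (Fin.zero_le i)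
    have h2 := hK t 0
    simp only [hs, Finset.sum_const, Finset.card_univ, Fintype.card_fin, smul_eq_mul] at h1
    by_contra! hlt
    have h3 : (k + 1) * (g 0 + 1) ≤ (k + 1) * (t + ε) := Nat.mul_le_mul_left _ hlt
    simp only [add_zero, mul_zero, zero_add] at h2
    rw [mul_add] at h3
    omega
  have hprob : ∀ t, geomProb q ((k + 1) * t + j₀) (k + 1) k.succ_pos
      {f | (f 0 : ℤ) = ⌈(((k + 1) * t + j₀ : ℕ) : ℚ) / ((k + 1 : ℕ) : ℚ)⌉ + (l : ℤ)} =
      q ^ l * (partsWithMax ((k + 1) * t + j₀) k (t + ε + l)).ncard /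
        ∑' i : ℕ, q ^ i * (partsWithMax ((k + 1) * t + j₀) k (t + ε + i)).ncard := by
    intro t
    have hset : {f : Fin (k + 1) → ℕ | (f 0 : ℤ) =
        ⌈(((k + 1) * t + j₀ : ℕ) : ℚ) / ((k + 1 : ℕ) : ℚ)⌉ + (l : ℤ)} =
        {f | f 0 = t + ε + l} := by
      ext f
      rw [Set.mem_ofPred_eq, hceil, Set.mem_ofPred_eq]
      exact_mod_cast Iff.rfl
    rw [hset, geomProb, geomWeight_largest_eq, geomWeight_univ _ _ _ _ (hmin t)]
    simp only [pow_add q (t + ε), mul_assoc]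
    rw [tsum_mul_left, mul_div_mul_left _ _ (pow_pos hq0 _).ne']
  have hlim : ∀ i, Filter.Tendsto
      (fun t => q ^ i * ((partsWithMax ((k + 1) * t + j₀) k (t + ε + i)).ncard : ℝ))
      Filter.atTop (nhds (q ^ i * (numPart ((k + 1) * i + d) k : ℝ))) := fun i => by
    refine tendsto_const_nhds.congr' ?_
    filter_upwards [Filter.eventually_ge_atTop ((k + 1) * i + d)] with t ht
    rw [ncard_partsWithMax_eq (hK t i) (by omega)]
  have hsummable := summable_pow_mul_numPart hq0.le hq1 k d
  have hpos : 0 < ∑' i : ℕ, q ^ i * (numPart ((k + 1) * i + d) k : ℝ) :=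
    hsummable.tsum_pos (fun i => by positivity) 0
      (mul_pos (pow_pos hq0 _) (Nat.cast_pos.2 (numPart_pos _ (by omega))))
  refine Filter.Tendsto.congr (fun t => (hprob t).symm) ((hlim l).div ?_ hpos.ne')
  refine tendsto_tsum_of_dominated_convergence hsummable hlim (Filter.Eventually.of_forall ?_)
  intro t i
  rw [Real.norm_of_nonneg (by positivity)]
  gcongr
  exact ncard_partsWithMax_le (hK t i)
end

section
/- For u > 0 let v = v(u) > 0 be determined implicitly by u² = v² / ∫₀^v t/(e^t − 1) dt. Then v is differentiable on (0,∞) with v′(u) = v/u + u·v / (2(e^v − 1 − u²/2)). In particular v′(u) > 0 for all u > 0, so v(u) is strictly increasing on (0,∞). -/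
open Set Filter Topology

lemma exp_sub_one_pos {t : ℝ} (ht : 0 < t) : 0 < Real.exp t - 1 := by
  linarith [Real.add_one_lt_exp ht.ne']

lemma div_exp_sub_one_le_of_le {s t : ℝ} (hs : 0 < s) (hst : s ≤ t) :
    t / (Real.exp t - 1) ≤ s / (Real.exp s - 1) := by
  have ht : 0 < t := hs.trans_le hst
  have h := convexOn_exp.secant_mono (mem_univ 0) (mem_univ s) (mem_univ t) hs.ne' ht.ne' hst
  simp only [Real.exp_zero, sub_zero] at h
  rw [div_le_div_iff₀ hs ht] at h
  rw [div_le_div_iff₀ (exp_sub_one_pos ht) (exp_sub_one_pos hs)]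
  linarith

lemma measurable_div_exp_sub_one : Measurable fun t : ℝ => t / (Real.exp t - 1) := by
  fun_prop

lemma intervalIntegrable_div_exp_sub_one {x : ℝ} (hx : 0 < x) :
    IntervalIntegrable (fun t : ℝ => t / (Real.exp t - 1)) MeasureTheory.volume 0 x := by
  refine (intervalIntegrable_const (c := (1 : ℝ))).mono_fun
    measurable_div_exp_sub_one.aestronglyMeasurable ?_
  refine (MeasureTheory.ae_restrict_iff' measurableSet_uIoc).2 (Eventually.of_forall ?_)
  intro t ht
  rw [uIoc_of_le hx.le] at ht
  have hpos := exp_sub_one_pos ht.1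
  beta_reduce
  rw [Real.norm_of_nonneg (div_pos ht.1 hpos).le, norm_one, div_le_one hpos]
  linarith [Real.add_one_le_exp t]

lemma sq_div_exp_sub_one_le_integral {x : ℝ} (hx : 0 < x) :
    x ^ 2 / (Real.exp x - 1) ≤ ∫ t in (0 : ℝ)..x, t / (Real.exp t - 1) := by
  have h := intervalIntegral.integral_mono_on_of_le_Ioo hx.le
    (intervalIntegrable_const (c := x / (Real.exp x - 1)))
    (intervalIntegrable_div_exp_sub_one hx)
    fun t ht => div_exp_sub_one_le_of_le ht.1 ht.2.le
  rw [intervalIntegral.integral_const, smul_eq_mul, sub_zero] at h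
  calc x ^ 2 / (Real.exp x - 1) = x * (x / (Real.exp x - 1)) := by ring
    _ ≤ _ := h

lemma integral_div_exp_sub_one_pos {x : ℝ} (hx : 0 < x) :
    0 < ∫ t in (0 : ℝ)..x, t / (Real.exp t - 1) :=
  (div_pos (pow_pos hx 2) (exp_sub_one_pos hx)).trans_le (sq_div_exp_sub_one_le_integral hx)

lemma hasDerivAt_integral_div_exp_sub_one {x : ℝ} (hx : 0 < x) :
    HasDerivAt (fun y : ℝ => ∫ t in (0 : ℝ)..y, t / (Real.exp t - 1))
      (x / (Real.exp x - 1)) x := by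
  refine intervalIntegral.integral_hasDerivAt_right (intervalIntegrable_div_exp_sub_one hx)
    measurable_div_exp_sub_one.stronglyMeasurable.stronglyMeasurableAtFilter ?_
  exact continuousAt_id.div (by fun_prop) (exp_sub_one_pos hx).ne'

lemma hasDerivAt_sq_div_integral {x : ℝ} (hx : 0 < x) :
    HasDerivAt (fun y : ℝ => y ^ 2 / ∫ t in (0 : ℝ)..y, t / (Real.exp t - 1))
      ((2 * x * (∫ t in (0 : ℝ)..x, t / (Real.exp t - 1)) - x ^ 2 * (x / (Real.exp x - 1))) /
        (∫ t in (0 : ℝ)..x, t / (Real.exp t - 1)) ^ 2) x := by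
  have h := (hasDerivAt_pow 2 x).fun_div (hasDerivAt_integral_div_exp_sub_one hx)
    (integral_div_exp_sub_one_pos hx).ne'
  simp only [Nat.cast_ofNat, Nat.add_one_sub_one, pow_one] at h
  exact h

lemma strictMonoOn_sq_div_integral :
    StrictMonoOn (fun y : ℝ => y ^ 2 / ∫ t in (0 : ℝ)..y, t / (Real.exp t - 1)) (Ioi 0) := by
  refine strictMonoOn_of_deriv_pos (convex_Ioi 0)
    (fun x hx => (hasDerivAt_sq_div_integral hx).continuousAt.continuousWithinAt) ?_
  intro x hx
  rw [interior_Ioi] at hx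
  rw [(hasDerivAt_sq_div_integral hx).deriv]
  have hx' : 0 < x := hx
  have hI := integral_div_exp_sub_one_pos hx'
  have hle := mul_le_mul_of_nonneg_left (sq_div_exp_sub_one_le_integral hx') hx'.le
  have heq : x ^ 2 * (x / (Real.exp x - 1)) = x * (x ^ 2 / (Real.exp x - 1)) := by ring
  refine div_pos ?_ (pow_pos hI 2)
  nlinarith [mul_pos hx' hI]

/-- If `v = v(u) > 0` is determined by `u² = v² / ∫₀^v t/(eᵗ-1) dt`, then `v` is
differentiable on `(0,∞)` with `v′(u) = v/u + uv/(2(e^v - 1 - u²/2))`; in particular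
`v′(u) > 0`, so `v` is strictly increasing on `(0,∞)`. -/
theorem stmt_7 (v : ℝ → ℝ)
    (hv : ∀ u : ℝ, 0 < u → 0 < v u ∧
      u ^ 2 = (v u) ^ 2 / ∫ t in (0 : ℝ)..(v u), t / (Real.exp t - 1)) :
    (∀ u : ℝ, 0 < u →
      HasDerivAt v (v u / u + u * v u / (2 * (Real.exp (v u) - 1 - u ^ 2 / 2))) u ∧
      0 < v u / u + u * v u / (2 * (Real.exp (v u) - 1 - u ^ 2 / 2))) ∧
    StrictMonoOn v (Set.Ioi (0 : ℝ)) := by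
  have hmono : StrictMonoOn v (Ioi 0) := by
    intro a ha b hb hab
    by_contra! hle
    have h := strictMonoOn_sq_div_integral.monotoneOn (hv b hb).1 (hv a ha).1 hle
    simp only [← (hv b hb).2, ← (hv a ha).2] at h
    exact h.not_gt (pow_lt_pow_left₀ hab (le_of_lt ha) two_ne_zero)
  have himage : v '' Ioi 0 = Ioi 0 := by
    refine Subset.antisymm (image_subset_iff.2 fun u hu => (hv u hu).1) fun x hx => ?_
    have hG : 0 < x ^ 2 / ∫ t in (0 : ℝ)..x, t / (Real.exp t - 1) :=
      div_pos (pow_pos hx 2) (integral_div_exp_sub_one_pos hx)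
    have hu := Real.sqrt_pos.2 hG
    refine ⟨_, hu, strictMonoOn_sq_div_integral.injOn (hv _ hu).1 hx ?_⟩
    simp only [← (hv _ hu).2, Real.sq_sqrt hG.le]
  refine ⟨fun u hu => ?_, hmono⟩
  obtain ⟨hvu, heq⟩ := hv u hu
  have hcont : ContinuousAt v u :=
    hmono.continuousAt_of_image_mem_nhds (Ioi_mem_nhds hu) (by rw [himage]; exact Ioi_mem_nhds hvu)
  have hI := integral_div_exp_sub_one_pos hvu
  have hE := exp_sub_one_pos hvu
  have hle := sq_div_exp_sub_one_le_integral hvu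
  have hD := hasDerivAt_sq_div_integral hvu
  generalize hIdef : (∫ t in (0 : ℝ)..(v u), t / (Real.exp t - 1)) = I at heq hI hle hD
  have huE : u ^ 2 ≤ Real.exp (v u) - 1 := by
    rw [heq, div_le_iff₀ hI]
    rw [div_le_iff₀ hE] at hle
    linarith
  have hu2 : 0 < u ^ 2 := pow_pos hu 2
  have hden : 0 < Real.exp (v u) - 1 - u ^ 2 / 2 := by linarith
  refine ⟨?_, by positivity⟩
  have hIeq : I = v u ^ 2 / u ^ 2 := by rw [heq]; field_simp
  have hsqrt : √(v u ^ 2 / I) = u := by rw [← heq, Real.sqrt_sq hu.le]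
  have hS := hD.sqrt (by simp only [hIdef, ← heq]; exact hu2.ne')
  simp only [hIdef, hsqrt] at hS
  have hpos : 0 < (2 * v u * I - v u ^ 2 * (v u / (Real.exp (v u) - 1))) / I ^ 2 / (2 * u) := by
    have h := mul_le_mul_of_nonneg_left hle hvu.le
    have h' : v u ^ 2 * (v u / (Real.exp (v u) - 1)) = v u * (v u ^ 2 / (Real.exp (v u) - 1)) := by
      ring
    have : 0 < 2 * v u * I - v u ^ 2 * (v u / (Real.exp (v u) - 1)) := by
      nlinarith [mul_pos hvu hI]
    positivity
  have key := hS.of_local_left_inverse hcont hpos.ne' (by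
    filter_upwards [Ioi_mem_nhds hu] with y hy
    rw [← (hv y hy).2, Real.sqrt_sq (le_of_lt hy)])
  refine key.congr_deriv ?_
  rw [inv_eq_iff_eq_inv, hIeq]
  generalize Real.exp (v u) - 1 = E at *
  generalize v u = w at *
  have h2 : 2 * E - u ^ 2 ≠ 0 := by linarith
  have h3 : w / u + u * w / (2 * (E - u ^ 2 / 2)) = 2 * w * E / (u * (2 * E - u ^ 2)) := by
    have h4 : 2 * (E - u ^ 2 / 2) = 2 * E - u ^ 2 := by ring
    rw [h4]; field_simp; ring
  rw [h3, inv_div]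
  field_simp
end
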